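/- (Discrete energy dissipation law, Theorem 3.1.) Let g ≥ 0, ε > 0 and suppose the maximum time step satisfies τ^α ≤ 3/(Γ(2−α)(4g² + 3ε)). If u⁰, u¹, …, u^N ∈ V_h satisfy the variable-step L1 scheme D_τ^α u^n = −μ^n with μ^n := (1+Δ_h)² u^n + f(u^n) for 1 ≤ n ≤ N, then the modified discrete energy is nonincreasing: 𝓔[u^n] ≤ 𝓔[u^{n−1}] for every 1 ≤ n ≤ N. -/

import Mathlib

open scoped BigOperators

/-- ω_β(t) = t^{β-1}/Γ(β) -/
noncomputable def omegaK (β t : ℝ) : ℝ := t ^ (β - 1) / Real.Gamma β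

/-- variable-step L1 kernel: `aK α t n k = a^{(n)}_{n-k}` for `1 ≤ k ≤ n`. -/
noncomputable def aK (α : ℝ) (t : ℕ → ℝ) (n k : ℕ) : ℝ :=
  (1 / (t k - t (k - 1))) * ∫ s in (t (k - 1))..(t k), omegaK (1 - α) (t n - s)

/-- DCC kernel: `pK α t n m = p^{(n)}_m`, i.e. `p^{(n)}_{n-k} = pK α t n (n-k)`;
`p^{(n)}_0 = 1/a^{(n)}_0` and
`p^{(n)}_{n-k} = (1/a^{(k)}_0) Σ_{j=k+1}^n (a^{(j)}_{j-k-1} - a^{(j)}_{j-k}) p^{(n)}_{n-j}`. -/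
noncomputable def pK (α : ℝ) (t : ℕ → ℝ) (n : ℕ) : ℕ → ℝ
  | 0 => 1 / aK α t n n
  | m + 1 =>
      (1 / aK α t (n - m - 1) (n - m - 1)) *
        ∑ i ∈ (Finset.range (m + 1)).attach,
          (aK α t (n - i.1) (n - m) - aK α t (n - i.1) (n - m - 1)) * pK α t n i.1
  decreasing_by exact Finset.mem_range.mp i.2

/-- discrete Laplacian on `L`-periodic grid functions (indices mod `M`) -/
noncomputable def dLap (M : ℕ) (h : ℝ) (v : ZMod M → ZMod M → ℝ) : ZMod M → ZMod M → ℝ :=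
  fun i j => (v (i + 1) j + v (i - 1) j + v i (j + 1) + v i (j - 1) - 4 * v i j) / h ^ 2

/-- discrete inner product ⟨v,w⟩ = h² Σ_{ij} v_{ij} w_{ij} -/
noncomputable def dInner (M : ℕ) [NeZero M] (h : ℝ) (v w : ZMod M → ZMod M → ℝ) : ℝ :=
  h ^ 2 * ∑ i : ZMod M, ∑ j : ZMod M, v i j * w i j

/-- discrete L² norm -/
noncomputable def dNorm (M : ℕ) [NeZero M] (h : ℝ) (v : ZMod M → ZMod M → ℝ) : ℝ :=
  Real.sqrt (dInner M h v v)

/-- the operator (1+Δ_h) -/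
noncomputable def opA (M : ℕ) (h : ℝ) (v : ZMod M → ZMod M → ℝ) : ZMod M → ZMod M → ℝ :=
  v + dLap M h v

/-- pointwise nonlinearity f(u) = u³ - g u² - ε u -/
noncomputable def fPt (g ε : ℝ) (M : ℕ) (v : ZMod M → ZMod M → ℝ) : ZMod M → ZMod M → ℝ :=
  fun i j => (v i j) ^ 3 - g * (v i j) ^ 2 - ε * v i j

/-- discrete energy E[v] = ½‖(1+Δ_h)v‖² + ¼‖v‖₄⁴ - (g/3)⟨v²,v⟩ - (ε/2)‖v‖² -/
noncomputable def dEnergy (M : ℕ) [NeZero M] (h g ε : ℝ) (v : ZMod M → ZMod M → ℝ) : ℝ :=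
  (1 / 2) * dInner M h (opA M h v) (opA M h v)
    + (1 / 4) * (h ^ 2 * ∑ i : ZMod M, ∑ j : ZMod M, |v i j| ^ 4)
    - (g / 3) * dInner M h (fun i j => (v i j) ^ 2) v
    - (ε / 2) * dInner M h v v

/-- chemical potential μ = (1+Δ_h)² v + f(v) -/
noncomputable def muSH (M : ℕ) (h g ε : ℝ) (v : ZMod M → ZMod M → ℝ) : ZMod M → ZMod M → ℝ :=
  opA M h (opA M h v) + fPt g ε M v

theorem tlt {t : ℕ → ℝ} {N : ℕ} (ht : ∀ k, k < N → t k < t (k + 1)) {i j : ℕ}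
    (hij : i < j) (hj : j ≤ N) : t i < t j := by
  induction j with
  | zero => omega
  | succ j ih =>
    rcases Nat.lt_succ_iff_lt_or_eq.mp hij with h | h
    · exact (ih h (by omega)).trans (ht j (by omega))
    · subst h; exact ht i (by omega)

theorem tle {t : ℕ → ℝ} {N : ℕ} (ht : ∀ k, k < N → t k < t (k + 1)) {i j : ℕ}
    (hij : i ≤ j) (hj : j ≤ N) : t i ≤ t j := by
  rcases hij.lt_or_eq with h | h
  · exact (tlt ht h hj).le
  · rw [h]

theorem omegaK_int {α : ℝ} (hα : 0 < α ∧ α < 1) (c a b : ℝ) :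
    IntervalIntegrable (fun s => omegaK (1 - α) (c - s)) MeasureTheory.volume a b := by
  unfold omegaK
  apply IntervalIntegrable.div_const
  have h := (intervalIntegral.intervalIntegrable_rpow' (a := c - a) (b := c - b)
    (r := 1 - α - 1) (by linarith [hα.2])).comp_sub_left c
  simpa using h

theorem omegaK_pos {α : ℝ} (hα : 0 < α ∧ α < 1) {x : ℝ} (hx : 0 < x) :
    0 < omegaK (1 - α) x := by
  unfold omegaK
  have := Real.Gamma_pos_of_pos (s := 1 - α) (by linarith [hα.2])
  have := Real.rpow_pos_of_pos hx (1 - α - 1)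
  positivity

theorem aK_pos {α : ℝ} (hα : 0 < α ∧ α < 1) {t : ℕ → ℝ} {N : ℕ}
    (ht : ∀ k, k < N → t k < t (k + 1)) {n k : ℕ} (hk : 1 ≤ k) (hkn : k ≤ n) (hn : n ≤ N) :
    0 < aK α t n k := by
  have h1 : t (k - 1) < t k := tlt ht (by omega) (by omega)
  have h2 : t k ≤ t n := tle ht hkn hn
  unfold aK
  apply mul_pos (by have := sub_pos.mpr h1; positivity)
  refine intervalIntegral.intervalIntegral_pos_of_pos_on (omegaK_int hα _ _ _) ?_ h1
  intro x hx
  exact omegaK_pos hα (by linarith [hx.2])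

theorem aK_anti {α : ℝ} (hα : 0 < α ∧ α < 1) {t : ℕ → ℝ} {N : ℕ}
    (ht : ∀ k, k < N → t k < t (k + 1)) {n j k : ℕ} (hk : 1 ≤ k) (hkj : k ≤ j) (hjn : j ≤ n)
    (hn : n ≤ N) : aK α t n k ≤ aK α t j k := by
  have h1 : t (k - 1) < t k := tlt ht (by omega) (by omega)
  have h2 : t k ≤ t j := tle ht hkj (by omega)
  have h3 : t j ≤ t n := tle ht hjn hn
  unfold aK
  apply mul_le_mul_of_nonneg_left _ (by have := sub_pos.mpr h1; positivity)
  refine intervalIntegral.integral_mono_on_of_le_Ioo h1.le (omegaK_int hα _ _ _)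
    (omegaK_int hα _ _ _) ?_
  intro x hx
  unfold omegaK
  have := Real.Gamma_pos_of_pos (s := 1 - α) (by linarith [hα.2])
  apply div_le_div_of_nonneg_right _ this.le
  exact Real.rpow_le_rpow_of_nonpos (by linarith [hx.2]) (by linarith) (by linarith [hα.1])

theorem omega_cross {α : ℝ} (hα : 0 < α ∧ α < 1) {a b s s' : ℝ} (hs : s ≤ s') (hb : s' < a)
    (hab : a ≤ b) :
    omegaK (1 - α) (a - s) * omegaK (1 - α) (b - s') ≤
      omegaK (1 - α) (b - s) * omegaK (1 - α) (a - s') := by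
  have hG := Real.Gamma_pos_of_pos (s := 1 - α) (by linarith [hα.2])
  unfold omegaK
  rw [div_mul_div_comm, div_mul_div_comm, ← Real.mul_rpow (by linarith) (by linarith),
    ← Real.mul_rpow (by linarith) (by linarith)]
  apply div_le_div_of_nonneg_right _ (by positivity)
  apply Real.rpow_le_rpow_of_nonpos
  · exact mul_pos (by linarith) (by linarith)
  · nlinarith [mul_nonneg (sub_nonneg.2 hab) (sub_nonneg.2 hs)]
  · linarith [hα.1]

theorem aK_cross {α : ℝ} (hα : 0 < α ∧ α < 1) {t : ℕ → ℝ} {N : ℕ}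
    (ht : ∀ k, k < N → t k < t (k + 1)) {n j k : ℕ} (hk : 1 ≤ k) (hkj : k + 1 ≤ j) (hjn : j ≤ n)
    (hn : n ≤ N) : aK α t j k * aK α t n (k + 1) ≤ aK α t n k * aK α t j (k + 1) := by
  have h1 : t (k - 1) < t k := tlt ht (by omega) (by omega)
  have h1' : t k < t (k + 1) := tlt ht (by omega) (by omega)
  have h2 : t (k + 1) ≤ t j := tle ht hkj (by omega)
  have h3 : t j ≤ t n := tle ht hjn hn
  have p1 : 0 < omegaK (1 - α) (t j - t k) := omegaK_pos hα (by linarith)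
  have p2 : 0 < omegaK (1 - α) (t n - t k) := omegaK_pos hα (by linarith)
  have hx : omegaK (1 - α) (t n - t k) * aK α t j k ≤
      omegaK (1 - α) (t j - t k) * aK α t n k := by
    unfold aK
    rw [mul_left_comm, mul_left_comm (omegaK (1 - α) (t j - t k))]
    apply mul_le_mul_of_nonneg_left _ (by have := sub_pos.mpr h1; positivity)
    rw [← intervalIntegral.integral_const_mul, ← intervalIntegral.integral_const_mul]
    refine intervalIntegral.integral_mono_on_of_le_Ioo h1.le ((omegaK_int hα _ _ _).const_mul _)
      ((omegaK_int hα _ _ _).const_mul _) ?_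
    intro x hx
    have := omega_cross hα (a := t j) (b := t n) hx.2.le (by linarith) h3
    linarith
  have hy : omegaK (1 - α) (t j - t k) * aK α t n (k + 1) ≤
      omegaK (1 - α) (t n - t k) * aK α t j (k + 1) := by
    unfold aK
    rw [mul_left_comm, mul_left_comm (omegaK (1 - α) (t n - t k))]
    rw [Nat.add_sub_cancel]
    apply mul_le_mul_of_nonneg_left _ (by have := sub_pos.mpr h1'; positivity)
    rw [← intervalIntegral.integral_const_mul, ← intervalIntegral.integral_const_mul]
    refine intervalIntegral.integral_mono_on_of_le_Ioo h1'.le ((omegaK_int hα _ _ _).const_mul _)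
      ((omegaK_int hα _ _ _).const_mul _) ?_
    intro x hx
    exact omega_cross hα (a := t j) (b := t n) hx.1.le (by linarith [hx.2]) h3
  have a1 := (aK_pos hα ht (n := j) (k := k) hk (by omega) (by omega)).le
  have a2 := (aK_pos hα ht (n := j) (k := k + 1) (by omega) (by omega) (by omega)).le
  have := mul_le_mul_of_nonneg_left hy a1
  have := mul_le_mul_of_nonneg_right hx a2
  refine le_of_mul_le_mul_left ?_ p1
  linarith

theorem aK_diag {α : ℝ} (hα : 0 < α ∧ α < 1) {t : ℕ → ℝ} {n : ℕ} (h1 : t (n - 1) < t n) :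
    aK α t n n = 1 / (Real.Gamma (2 - α) * (t n - t (n - 1)) ^ α) := by
  unfold aK omegaK
  have hp := sub_pos.2 h1
  have hG := Real.Gamma_pos_of_pos (s := 1 - α) (by linarith [hα.2])
  have hG2 : Real.Gamma (2 - α) = (1 - α) * Real.Gamma (1 - α) := by
    rw [← Real.Gamma_add_one (by linarith [hα.2])]; congr 1; ring
  rw [intervalIntegral.integral_div,
    intervalIntegral.integral_comp_sub_left (fun x => x ^ (1 - α - 1)) (t n),
    integral_rpow (Or.inl (by linarith [hα.2])), hG2, sub_self, sub_add_cancel,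
    Real.zero_rpow (by linarith [hα.2]), Real.rpow_sub hp, Real.rpow_one]
  have := Real.rpow_pos_of_pos hp α
  have : 1 - α ≠ 0 := by linarith [hα.2]
  field_simp
  ring

theorem pK_succ (α : ℝ) (t : ℕ → ℝ) (n m : ℕ) : pK α t n (m + 1) =
      (1 / aK α t (n - m - 1) (n - m - 1)) *
        ∑ i ∈ Finset.range (m + 1),
          (aK α t (n - i) (n - m) - aK α t (n - i) (n - m - 1)) * pK α t n i := by
  rw [pK, Finset.sum_attach (Finset.range (m + 1)) (fun i =>
    (aK α t (n - i) (n - m) - aK α t (n - i) (n - m - 1)) * pK α t n i)]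

theorem pK_id {α : ℝ} {t : ℕ → ℝ} {n : ℕ} (h : ∀ k, 1 ≤ k → k ≤ n → aK α t k k ≠ 0)
    (m : ℕ) (hm : m < n) :
    ∑ i ∈ Finset.range (m + 1), pK α t n i * aK α t (n - i) (n - m) = 1 := by
  induction m with
  | zero =>
    have := h n (by omega) le_rfl
    simp [pK, this]
  | succ m ih =>
    have h0 := h (n - m - 1) (by omega) (by omega)
    rw [Finset.sum_range_succ, pK_succ, show n - (m + 1) = n - m - 1 by omega,
      mul_right_comm, one_div_mul_cancel h0, one_mul, ← Finset.sum_add_distrib, ← ih (by omega)]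
    refine Finset.sum_congr rfl fun i _ => by ring

theorem pK_id' {α : ℝ} {t : ℕ → ℝ} {n : ℕ} (h : ∀ k, 1 ≤ k → k ≤ n → aK α t k k ≠ 0)
    (k : ℕ) (hk : 1 ≤ k) (hkn : k ≤ n) :
    ∑ j ∈ Finset.Icc k n, pK α t n (n - j) * aK α t j k = 1 := by
  rw [← pK_id h (n - k) (by omega)]
  refine Finset.sum_bij' (fun j _ => n - j) (fun i _ => n - i) ?_ ?_ ?_ ?_ ?_
  · intro j hj; simp at hj ⊢; omega
  · intro j hj; simp at hj ⊢; omega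
  · intro j hj; simp at hj ⊢; omega
  · intro j hj; simp at hj ⊢; omega
  · intro j hj; simp at hj
    rw [show n - (n - j) = j by omega, show n - (n - k) = k by omega]

theorem q_nonpos {A : ℕ → ℕ → ℝ} {q : ℕ → ℝ} {n : ℕ}
    (hpos : ∀ k j, 1 ≤ k → k ≤ j → j ≤ n → 0 < A j k)
    (hcr : ∀ k j, 1 ≤ k → k + 1 ≤ j → j ≤ n → A j k * A n (k + 1) ≤ A n k * A j (k + 1))
    (hq : ∀ k, 1 ≤ k → k < n → ∑ j ∈ Finset.Icc k n, q j * A j k = 0)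
    (hqn : 0 ≤ q n) (m : ℕ) : ∀ k, 1 ≤ k → k < n → n - k = m → q k ≤ 0 := by
  induction m using Nat.strong_induction_on with
  | _ m ih =>
  intro k hk hkn hm
  have e1 := hq k hk hkn
  rw [← Finset.add_sum_Ioc_eq_sum_Icc (by omega)] at e1
  have pk := hpos k k hk le_rfl hkn.le
  suffices 0 ≤ ∑ j ∈ Finset.Ioc k n, q j * A j k by
    by_contra hc
    push Not at hc
    have := mul_pos hc pk
    linarith
  rcases Nat.lt_or_ge (k + 1) n with h | h
  · have e2 := hq (k + 1) (by omega) h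
    have hI : Finset.Icc (k + 1) n = Finset.Ioc k n := by
      ext; simp only [Finset.mem_Icc, Finset.mem_Ioc]; omega
    rw [hI] at e2
    have pn := hpos (k + 1) n (by omega) (by omega) le_rfl
    refine nonneg_of_mul_nonneg_left ?_ pn
    have : ∑ j ∈ Finset.Ioc k n, A n k * (q j * A j (k + 1)) ≤
        ∑ j ∈ Finset.Ioc k n, q j * A j k * A n (k + 1) := by
      apply Finset.sum_le_sum
      intro j hj
      simp at hj
      rcases hj.2.lt_or_eq with h' | h'
      · have := ih (n - j) (by omega) j (by omega) h' rfl
        nlinarith [hcr k j hk (by omega) hj.2]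
      · subst h'; apply le_of_eq; ring
    rw [← Finset.mul_sum, e2, mul_zero] at this
    rwa [Finset.sum_mul]
  · have : n = k + 1 := by omega
    subst this
    simp
    exact mul_nonneg hqn (hpos k (k+1) hk (by omega) le_rfl).le

theorem q_sum {A : ℕ → ℕ → ℝ} {q : ℕ → ℝ} {n : ℕ} (hn : 1 ≤ n)
    (hpos : 0 < A n 1)
    (hanti : ∀ j, 1 ≤ j → j ≤ n → A n 1 ≤ A j 1)
    (hq : 0 ≤ ∑ j ∈ Finset.Icc 1 n, q j * A j 1)
    (hqk : ∀ k, 1 ≤ k → k < n → q k ≤ 0) : 0 ≤ ∑ j ∈ Finset.Icc 1 n, q j := by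
  refine nonneg_of_mul_nonneg_left (b := A n 1) (hq.trans ?_) hpos
  rw [Finset.sum_mul]
  apply Finset.sum_le_sum
  intro j hj
  simp at hj
  rcases hj.2.lt_or_eq with h' | h'
  · exact mul_le_mul_of_nonpos_left (hanti j hj.1 hj.2) (hqk j hj.1 h')
  · rw [h']

theorem scalar_key {q m : ℕ → ℝ} {n : ℕ} {a d : ℝ} (hn : 1 ≤ n) (hqn : q n * a = 1)
    (hqk : ∀ k, 1 ≤ k → k < n → q k ≤ 0) (hs : 0 ≤ ∑ j ∈ Finset.Icc 1 n, q j)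
    (hd : d = -∑ j ∈ Finset.Icc 1 n, q j * m j) :
    m n * d + 1 / 2 * ∑ j ∈ Finset.Icc 1 n, q j * m j ^ 2 + a / 2 * d ^ 2 ≤ 0 := by
  set z := m n + a * d with hz
  have h1 : ∑ j ∈ Finset.Icc 1 n, q j * (m j - z) ^ 2 ≤ a * d ^ 2 := by
    rw [← Finset.sum_Ico_add_eq_sum_Icc hn]
    have : ∑ j ∈ Finset.Ico 1 n, q j * (m j - z) ^ 2 ≤ 0 := by
      apply Finset.sum_nonpos
      intro j hj
      simp at hj
      exact mul_nonpos_of_nonpos_of_nonneg (hqk j hj.1 hj.2) (sq_nonneg _)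
    have h3 : q n * (m n - z) ^ 2 = a * d ^ 2 := by
      rw [hz]
      linear_combination (a * d ^ 2) * hqn
    linarith
  have h2 : ∑ j ∈ Finset.Icc 1 n, q j * (m j - z) ^ 2 =
      ∑ j ∈ Finset.Icc 1 n, q j * m j ^ 2 - 2 * z * ∑ j ∈ Finset.Icc 1 n, q j * m j
        + z ^ 2 * ∑ j ∈ Finset.Icc 1 n, q j := by
    rw [Finset.mul_sum, Finset.mul_sum, ← Finset.sum_sub_distrib, ← Finset.sum_add_distrib]
    exact Finset.sum_congr rfl fun j _ => by ring
  have h3 := mul_nonneg (sq_nonneg z) hs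
  have h4 : ∑ j ∈ Finset.Icc 1 n, q j * m j = -d := by rw [hd]; ring
  rw [h4] at h2
  have : z * d = m n * d + a * d ^ 2 := by rw [hz]; ring
  nlinarith

theorem grid_shift (M : ℕ) [NeZero M] (c : ZMod M) (v w : ZMod M → ZMod M → ℝ) :
    ∑ i : ZMod M, ∑ j : ZMod M, v (i + c) j * w i j =
      ∑ i : ZMod M, ∑ j : ZMod M, v i j * w (i - c) j := by
  rw [← Equiv.sum_comp (Equiv.addRight c) (fun i => ∑ j : ZMod M, v i j * w (i - c) j)]
  simp

theorem grid_shift' (M : ℕ) [NeZero M] (c : ZMod M) (v w : ZMod M → ZMod M → ℝ) :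
    ∑ i : ZMod M, ∑ j : ZMod M, v i (j + c) * w i j =
      ∑ i : ZMod M, ∑ j : ZMod M, v i j * w i (j - c) := by
  refine Finset.sum_congr rfl fun i _ => ?_
  rw [← Equiv.sum_comp (Equiv.addRight c) (fun j => v i j * w i (j - c))]
  simp

theorem opA_symm (M : ℕ) [NeZero M] (h : ℝ) (v w : ZMod M → ZMod M → ℝ) :
    ∑ i : ZMod M, ∑ j : ZMod M, opA M h v i j * w i j =
      ∑ i : ZMod M, ∑ j : ZMod M, v i j * opA M h w i j := by
  have e1 := grid_shift M 1 v w
  have e2 := grid_shift M (-1) v w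
  have e3 := grid_shift' M 1 v w
  have e4 := grid_shift' M (-1) v w
  simp only [sub_neg_eq_add, ← sub_eq_add_neg] at e2 e4
  have L : ∑ i : ZMod M, ∑ j : ZMod M, opA M h v i j * w i j =
      ∑ i : ZMod M, ∑ j : ZMod M, v i j * w i j + (h ^ 2)⁻¹ * (
        ∑ i : ZMod M, ∑ j : ZMod M, v (i + 1) j * w i j
        + ∑ i : ZMod M, ∑ j : ZMod M, v (i - 1) j * w i j
        + ∑ i : ZMod M, ∑ j : ZMod M, v i (j + 1) * w i j
        + ∑ i : ZMod M, ∑ j : ZMod M, v i (j - 1) * w i j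
        - 4 * ∑ i : ZMod M, ∑ j : ZMod M, v i j * w i j) := by
    simp only [Finset.mul_sum, ← Finset.sum_add_distrib, ← Finset.sum_sub_distrib]
    refine Finset.sum_congr rfl fun i _ => Finset.sum_congr rfl fun j _ => ?_
    simp only [opA, dLap, Pi.add_apply]
    ring
  have R : ∑ i : ZMod M, ∑ j : ZMod M, v i j * opA M h w i j =
      ∑ i : ZMod M, ∑ j : ZMod M, v i j * w i j + (h ^ 2)⁻¹ * (
        ∑ i : ZMod M, ∑ j : ZMod M, v i j * w (i - 1) j
        + ∑ i : ZMod M, ∑ j : ZMod M, v i j * w (i + 1) j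
        + ∑ i : ZMod M, ∑ j : ZMod M, v i j * w i (j - 1)
        + ∑ i : ZMod M, ∑ j : ZMod M, v i j * w i (j + 1)
        - 4 * ∑ i : ZMod M, ∑ j : ZMod M, v i j * w i j) := by
    simp only [Finset.mul_sum, ← Finset.sum_add_distrib, ← Finset.sum_sub_distrib]
    refine Finset.sum_congr rfl fun i _ => Finset.sum_congr rfl fun j _ => ?_
    simp only [opA, dLap, Pi.add_apply]
    ring
  rw [L, R, e1, e2, e3, e4]

theorem pot_ineq (g ε v w a : ℝ) (ha : (4 * g ^ 2 + 3 * ε) / 3 ≤ a) :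
    (1 / 4 * v ^ 4 - g / 3 * v ^ 3 - ε / 2 * v ^ 2)
      - (1 / 4 * w ^ 4 - g / 3 * w ^ 3 - ε / 2 * w ^ 2) ≤
    (v ^ 3 - g * v ^ 2 - ε * v) * (v - w) + a / 2 * (v - w) ^ 2 := by
  have h1 : 0 ≤ (v - w) ^ 2 * (((v + w) / 2 - g / 3) ^ 2 + 1 / 2 * (v - g / 3) ^ 2) := by
    positivity
  have h2 : (g ^ 2 / 6 + ε / 2) * (v - w) ^ 2 ≤ a / 2 * (v - w) ^ 2 := by
    apply mul_le_mul_of_nonneg_right _ (sq_nonneg _)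
    nlinarith [sq_nonneg g]
  nlinarith

theorem energy_ineq (M : ℕ) [NeZero M] (h g ε a : ℝ) (v w : ZMod M → ZMod M → ℝ)
    (ha : (4 * g ^ 2 + 3 * ε) / 3 ≤ a) :
    dEnergy M h g ε v - dEnergy M h g ε w ≤ h ^ 2 * ∑ i : ZMod M, ∑ j : ZMod M,
      (muSH M h g ε v i j * (v i j - w i j) + a / 2 * (v i j - w i j) ^ 2) := by
  have hs := opA_symm M h (opA M h v) (fun i j => v i j - w i j)
  have hlin : ∀ i j, opA M h (fun i j => v i j - w i j) i j = opA M h v i j - opA M h w i j := by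
    intro i j
    simp only [opA, dLap, Pi.add_apply]
    ring
  simp only [hlin] at hs
  have e1 : ∀ v : ZMod M → ZMod M → ℝ, dEnergy M h g ε v = h ^ 2 * ∑ i : ZMod M, ∑ j : ZMod M,
      (1 / 2 * opA M h v i j ^ 2 +
        (1 / 4 * v i j ^ 4 - g / 3 * v i j ^ 3 - ε / 2 * v i j ^ 2)) := by
    intro v
    unfold dEnergy dInner
    simp only [Finset.mul_sum, ← Finset.sum_add_distrib, ← Finset.sum_sub_distrib]
    refine Finset.sum_congr rfl fun i _ => Finset.sum_congr rfl fun j _ => ?_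
    rw [show |v i j| ^ 4 = v i j ^ 4 from Even.pow_abs (by decide) _]
    ring
  have e2 : ∑ i : ZMod M, ∑ j : ZMod M,
      (muSH M h g ε v i j * (v i j - w i j) + a / 2 * (v i j - w i j) ^ 2) =
      ∑ i : ZMod M, ∑ j : ZMod M, (opA M h v i j * (opA M h v i j - opA M h w i j)
        + ((v i j ^ 3 - g * v i j ^ 2 - ε * v i j) * (v i j - w i j)
          + a / 2 * (v i j - w i j) ^ 2)) := by
    simp only [Finset.sum_add_distrib] at hs ⊢
    rw [← hs]
    simp only [← Finset.sum_add_distrib]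
    refine Finset.sum_congr rfl fun i _ => Finset.sum_congr rfl fun j _ => ?_
    simp only [muSH, fPt, Pi.add_apply]
    ring
  rw [e1, e1, e2, ← mul_sub]
  apply mul_le_mul_of_nonneg_left _ (sq_nonneg h)
  simp only [← Finset.sum_sub_distrib]
  refine Finset.sum_le_sum fun i _ => Finset.sum_le_sum fun j _ => ?_
  have := pot_ineq g ε (v i j) (w i j) a ha
  nlinarith [sq_nonneg (opA M h v i j - opA M h w i j)]

/-- Theorem 3.1, discrete energy dissipation law: under the step restriction
`τ^α ≤ 3/(Γ(2-α)(4g²+3ε))`, solutions of the variable-step L1 scheme `D_τ^α uⁿ = -μⁿ`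
have nonincreasing modified discrete energy `𝓔[uⁿ] = E[uⁿ] + ½ Σ_{j=1}^n p^{(n)}_{n-j}‖μ^j‖²`. -/
theorem discrete_energy_dissipation
    (L : ℝ) (hL : 0 < L) (M : ℕ) [NeZero M] (hM : 2 ≤ M)
    (g ε : ℝ) (hg : 0 ≤ g) (hε : 0 < ε)
    (N : ℕ) (α T : ℝ) (hα : 0 < α ∧ α < 1)
    (t : ℕ → ℝ) (ht0 : t 0 = 0) (htN : t N = T)
    (htmono : ∀ k, k < N → t k < t (k + 1))
    (hτ : ∀ k, 1 ≤ k → k ≤ N →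
      (t k - t (k - 1)) ^ α ≤ 3 / (Real.Gamma (2 - α) * (4 * g ^ 2 + 3 * ε)))
    (u : ℕ → ZMod M → ZMod M → ℝ)
    (hscheme : ∀ n, 1 ≤ n → n ≤ N →
      (∑ k ∈ Finset.Icc 1 n, aK α t n k • (u k - u (k - 1)))
        = -(muSH M (L / M) g ε (u n))) :
    ∀ n, 1 ≤ n → n ≤ N →
      dEnergy M (L / M) g ε (u n)
          + (1 / 2) * ∑ j ∈ Finset.Icc 1 n,
              pK α t n (n - j) *
                dInner M (L / M) (muSH M (L / M) g ε (u j)) (muSH M (L / M) g ε (u j)) ≤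
        dEnergy M (L / M) g ε (u (n - 1))
          + (1 / 2) * ∑ j ∈ Finset.Icc 1 (n - 1),
              pK α t (n - 1) (n - 1 - j) *
                dInner M (L / M) (muSH M (L / M) g ε (u j)) (muSH M (L / M) g ε (u j)) := by
  intro n hn hnN
  have hG := Real.Gamma_pos_of_pos (s := 2 - α) (by linarith [hα.2])
  have hpos : ∀ k j, 1 ≤ k → k ≤ j → j ≤ n → 0 < aK α t j k := fun k j h1 h2 h3 =>
    aK_pos hα htmono h1 h2 (h3.trans hnN)
  set h := L / (M : ℝ) with hh
  set A := aK α t with hA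
  have ha : (4 * g ^ 2 + 3 * ε) / 3 ≤ A n n := by
    have h1 : t (n - 1) < t n := tlt htmono (by omega) hnN
    have h2 := hτ n hn hnN
    have h3 := Real.rpow_pos_of_pos (sub_pos.2 h1) α
    have h4 : 0 < 4 * g ^ 2 + 3 * ε := by positivity
    rw [hA, aK_diag hα h1, div_le_div_iff₀ (by norm_num) (by positivity)]
    rw [le_div_iff₀ (by positivity)] at h2
    linarith
  -- the differences of consecutive DCC kernels
  let q : ℕ → ℝ := fun j => pK α t n (n - j) - if j = n then 0 else pK α t (n - 1) (n - 1 - j)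
  have hq : ∀ k, 1 ≤ k → k ≤ n →
      ∑ j ∈ Finset.Icc k n, q j * A j k = if k = n then 1 else 0 := by
    intro k hk hkn
    have h1 := pK_id' (α := α) (t := t) (n := n)
      (fun k h1 h2 => (hpos k k h1 le_rfl h2).ne') k hk hkn
    simp only [q, sub_mul, Finset.sum_sub_distrib]
    rw [hA, h1]
    split_ifs with hkn'
    · subst hkn'; simp
    · have h2 := pK_id' (α := α) (t := t) (n := n - 1)
        (fun k h1 h2 => (hpos k k h1 le_rfl (by omega)).ne') k hk (by omega)
      rw [← Finset.sum_Ico_add_eq_sum_Icc hkn]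
      have h3 : Finset.Ico k n = Finset.Icc k (n - 1) := by ext; simp; omega
      rw [h3]
      have h4 : ∑ j ∈ Finset.Icc k (n - 1),
          (if j = n then 0 else pK α t (n - 1) (n - 1 - j)) * aK α t j k = 1 := by
        rw [← h2]
        refine Finset.sum_congr rfl fun j hj => ?_
        simp at hj
        rw [if_neg (by omega)]
      rw [h4]
      simp
  have hqn : q n * A n n = 1 := by simpa using hq n hn le_rfl
  have pn := hpos n n hn le_rfl le_rfl
  have hqn0 : 0 ≤ q n := by
    by_contra hc
    push Not at hc
    nlinarith
  have hqk : ∀ k, 1 ≤ k → k < n → q k ≤ 0 := fun k h1 h2 =>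
    q_nonpos (A := A) (q := q) hpos
      (fun k j h1 h2 h3 => aK_cross hα htmono h1 h2 h3 hnN)
      (fun k h1 h2 => by rw [hq k h1 h2.le, if_neg (by omega)]) hqn0 (n - k) k h1 h2 rfl
  have hs : 0 ≤ ∑ j ∈ Finset.Icc 1 n, q j :=
    q_sum (A := A) hn (hpos 1 n le_rfl hn le_rfl)
      (fun j h1 h2 => aK_anti hα htmono le_rfl h1 h2 hnN)
      (by rw [hq 1 le_rfl hn]; split_ifs <;> norm_num) hqk
  have hd : ∀ x y, u n x y - u (n - 1) x y =
      -∑ j ∈ Finset.Icc 1 n, q j * muSH M h g ε (u j) x y := by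
    intro x y
    have h1 : ∀ j ∈ Finset.Icc 1 n, q j * muSH M h g ε (u j) x y =
        -∑ k ∈ Finset.Icc 1 j, q j * (A j k * (u k x y - u (k - 1) x y)) := by
      intro j hj
      simp at hj
      have := congrFun (congrFun (hscheme j hj.1 (hj.2.trans hnN)) x) y
      simp only [Finset.sum_apply, Pi.smul_apply, Pi.sub_apply, Pi.neg_apply, smul_eq_mul] at this
      rw [← Finset.mul_sum, this]
      ring
    rw [Finset.sum_congr rfl h1, Finset.sum_neg_distrib, neg_neg,
      Finset.sum_comm' (t' := Finset.Icc 1 n) (s' := fun k => Finset.Icc k n)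
        (by intro a b; simp; omega)]
    have h2 : ∀ k ∈ Finset.Icc 1 n,
        ∑ j ∈ Finset.Icc k n, q j * (A j k * (u k x y - u (k - 1) x y)) =
        if k = n then (u k x y - u (k - 1) x y) else 0 := by
      intro k hk
      simp at hk
      simp only [← mul_assoc]
      rw [← Finset.sum_mul, hq k hk.1 hk.2]
      split_ifs <;> simp
    rw [Finset.sum_congr rfl h2, Finset.sum_ite_eq' (Finset.Icc 1 n) n, if_pos (by simp [hn])]
  have hE := energy_ineq M h g ε (A n n) (u n) (u (n - 1)) ha
  have hkey : h ^ 2 * ∑ x : ZMod M, ∑ y : ZMod M,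
      (muSH M h g ε (u n) x y * (u n x y - u (n - 1) x y)
        + A n n / 2 * (u n x y - u (n - 1) x y) ^ 2) ≤
      h ^ 2 * ∑ x : ZMod M, ∑ y : ZMod M,
        -(1 / 2 * ∑ j ∈ Finset.Icc 1 n, q j * muSH M h g ε (u j) x y ^ 2) := by
    apply mul_le_mul_of_nonneg_left _ (sq_nonneg h)
    refine Finset.sum_le_sum fun x _ => Finset.sum_le_sum fun y _ => ?_
    have := scalar_key (m := fun j => muSH M h g ε (u j) x y) hn hqn hqk hs (hd x y)
    linarith
  have hsum : h ^ 2 * ∑ x : ZMod M, ∑ y : ZMod M,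
        -(1 / 2 * ∑ j ∈ Finset.Icc 1 n, q j * muSH M h g ε (u j) x y ^ 2) =
      -(1 / 2 * ∑ j ∈ Finset.Icc 1 n,
        q j * dInner M h (muSH M h g ε (u j)) (muSH M h g ε (u j))) := by
    unfold dInner
    simp only [Finset.mul_sum, ← Finset.sum_neg_distrib]
    conv_rhs => rw [Finset.sum_comm]
    refine Finset.sum_congr rfl fun x _ => ?_
    conv_rhs => rw [Finset.sum_comm]
    refine Finset.sum_congr rfl fun y _ => Finset.sum_congr rfl fun j _ => ?_
    ring
  have hsplit : ∑ j ∈ Finset.Icc 1 n,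
        q j * dInner M h (muSH M h g ε (u j)) (muSH M h g ε (u j)) =
      ∑ j ∈ Finset.Icc 1 n,
        pK α t n (n - j) * dInner M h (muSH M h g ε (u j)) (muSH M h g ε (u j)) -
      ∑ j ∈ Finset.Icc 1 (n - 1),
        pK α t (n - 1) (n - 1 - j) * dInner M h (muSH M h g ε (u j)) (muSH M h g ε (u j)) := by
    simp only [q, sub_mul, Finset.sum_sub_distrib]
    congr 1
    rw [← Finset.sum_Ico_add_eq_sum_Icc hn]
    have h3 : Finset.Ico 1 n = Finset.Icc 1 (n - 1) := by ext; simp; omega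
    rw [h3]
    simp only [if_true, zero_mul, add_zero]
    refine Finset.sum_congr rfl fun j hj => ?_
    simp at hj
    rw [if_neg (by omega)]
  rw [hsum, hsplit] at hkey
  linarith
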